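/- arXiv:2405.03260 — 5 statements merged into one kernel-verified Lean document; each statement's English description precedes it below -/
import Mathlib

section
/- Suppose U and V satisfy the (3,4) string equation (S1),(S2) and the KP flow equations (F1)–(F4) at every point of ℝ³. Then the Darboux coordinates of (U,V) satisfy Hamilton's equations in the variable t₁ = x with Hamiltonian H₁: for every a ∈ {U,V,W} and every (t₅,t₂,x) ∈ ℝ³, ∂Q_a/∂x = ∂H₁/∂P_a and ∂P_a/∂x = −∂H₁/∂Q_a, where the partial derivatives of the polynomial H₁ are evaluated at (Q_U(t₅,t₂,x), Q_V(t₅,t₂,x), Q_W(t₅,t₂,x), P_U(t₅,t₂,x), P_V(t₅,t₂,x), P_W(t₅,t₂,x), x, t₂, t₅). -/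
noncomputable def Ham1 {K : Type*} [Field K] (qU qV qW pU pV pW t1 t2 t5 : K) : K :=
  pU * qW + 6 * pW ^ 2 - (3/8) * qU * qW ^ 2 + (1/2) * pV ^ 2 - (1/8) * qU ^ 4
    - (3/2) * qU * qV ^ 2 - t1 * qU + 2 * t2 * qV
    + (1/8) * t5 * (16 * qU * pW - 2 * qU ^ 3 + 4 * qV ^ 2 - qW ^ 2)
    - (1/2) * t5 ^ 2 * (4 * pW - qU ^ 2)
    + (19/27) * t5 ^ 3 * qU + (41/54) * t5 ^ 4 - (4/3) * t5 * t1

noncomputable def DqU (H : ℝ → ℝ → ℝ → ℝ → ℝ → ℝ → ℝ → ℝ → ℝ → ℝ)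
    (qU qV qW pU pV pW t1 t2 t5 : ℝ) : ℝ :=
  deriv (fun s => H s qV qW pU pV pW t1 t2 t5) qU

noncomputable def DqV (H : ℝ → ℝ → ℝ → ℝ → ℝ → ℝ → ℝ → ℝ → ℝ → ℝ)
    (qU qV qW pU pV pW t1 t2 t5 : ℝ) : ℝ :=
  deriv (fun s => H qU s qW pU pV pW t1 t2 t5) qV

noncomputable def DqW (H : ℝ → ℝ → ℝ → ℝ → ℝ → ℝ → ℝ → ℝ → ℝ → ℝ)
    (qU qV qW pU pV pW t1 t2 t5 : ℝ) : ℝ :=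
  deriv (fun s => H qU qV s pU pV pW t1 t2 t5) qW

noncomputable def DpU (H : ℝ → ℝ → ℝ → ℝ → ℝ → ℝ → ℝ → ℝ → ℝ → ℝ)
    (qU qV qW pU pV pW t1 t2 t5 : ℝ) : ℝ :=
  deriv (fun s => H qU qV qW s pV pW t1 t2 t5) pU

noncomputable def DpV (H : ℝ → ℝ → ℝ → ℝ → ℝ → ℝ → ℝ → ℝ → ℝ → ℝ)
    (qU qV qW pU pV pW t1 t2 t5 : ℝ) : ℝ :=
  deriv (fun s => H qU qV qW pU s pW t1 t2 t5) pV

noncomputable def DpW (H : ℝ → ℝ → ℝ → ℝ → ℝ → ℝ → ℝ → ℝ → ℝ → ℝ)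
    (qU qV qW pU pV pW t1 t2 t5 : ℝ) : ℝ :=
  deriv (fun s => H qU qV qW pU pV s t1 t2 t5) pW

noncomputable def QUc (U : ℝ → ℝ → ℝ → ℝ) (t5 t2 x : ℝ) : ℝ :=
  U t5 t2 x - (4/3) * t5

noncomputable def QVc (V : ℝ → ℝ → ℝ → ℝ) (t5 t2 x : ℝ) : ℝ :=
  V t5 t2 x

noncomputable def QWc (U : ℝ → ℝ → ℝ → ℝ) (t5 t2 x : ℝ) : ℝ :=
  deriv (U t5 t2) x

noncomputable def PUc (U : ℝ → ℝ → ℝ → ℝ) (t5 t2 x : ℝ) : ℝ :=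
  (1/4) * (3 * U t5 t2 x * deriv (U t5 t2) x - (1/3) * deriv^[3] (U t5 t2) x
    - (7/3) * t5 * deriv (U t5 t2) x)

noncomputable def PVc (V : ℝ → ℝ → ℝ → ℝ) (t5 t2 x : ℝ) : ℝ :=
  deriv (V t5 t2) x

noncomputable def PWc (U : ℝ → ℝ → ℝ → ℝ) (t5 t2 x : ℝ) : ℝ :=
  (1/12) * deriv^[2] (U t5 t2) x - (1/6) * t5 * U t5 t2 x + (7/18) * t5 ^ 2

theorem hasDerivAt_iterate_deriv {f : ℝ → ℝ} (hf : ContDiff ℝ (⊤ : ℕ∞) f) (n : ℕ) (x : ℝ) :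
    HasDerivAt (deriv^[n] f) (deriv^[n + 1] f x) x := by
  rw [Function.iterate_succ_apply']
  exact (((hf.iterate_deriv n).differentiable (by simp)) x).hasDerivAt

theorem deriv_quartic (a b c d e x : ℝ) :
    deriv (fun s : ℝ => a * s ^ 4 + b * s ^ 3 + c * s ^ 2 + d * s + e) x
      = 4 * a * x ^ 3 + 3 * b * x ^ 2 + 2 * c * x + d := by
  have h : HasDerivAt (fun s : ℝ => a * s ^ 4 + b * s ^ 3 + c * s ^ 2 + d * s + e) _ x :=
    (((((hasDerivAt_pow 4 x).const_mul a).add ((hasDerivAt_pow 3 x).const_mul b)).add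
      ((hasDerivAt_pow 2 x).const_mul c)).add ((hasDerivAt_id' x).const_mul d)).add_const e
  rw [h.deriv]
  norm_num
  ring

theorem DqU_Ham1 (qU qV qW pU pV pW t1 t2 t5 : ℝ) :
    DqU Ham1 qU qV qW pU pV pW t1 t2 t5
      = -(1/2) * qU ^ 3 - 3/4 * t5 * qU ^ 2 + t5 ^ 2 * qU - 3/8 * qW ^ 2 - 3/2 * qV ^ 2 - t1
          + 2 * t5 * pW + 19/27 * t5 ^ 3 := by
  have h : (fun s : ℝ => Ham1 s qV qW pU pV pW t1 t2 t5) = fun s =>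
      (-(1/8)) * s ^ 4 + (-(1/4) * t5) * s ^ 3 + (1/2 * t5 ^ 2) * s ^ 2
        + (-(3/8) * qW ^ 2 - 3/2 * qV ^ 2 - t1 + 2 * t5 * pW + 19/27 * t5 ^ 3) * s
        + Ham1 0 qV qW pU pV pW t1 t2 t5 := by
    funext s
    simp only [Ham1]
    ring
  rw [DqU, h, deriv_quartic]
  ring

theorem DqV_Ham1 (qU qV qW pU pV pW t1 t2 t5 : ℝ) :
    DqV Ham1 qU qV qW pU pV pW t1 t2 t5
      = (t5 - 3 * qU) * qV + 2 * t2 := by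
  have h : (fun s : ℝ => Ham1 qU s qW pU pV pW t1 t2 t5) = fun s =>
      0 * s ^ 4 + 0 * s ^ 3 + (1/2 * t5 - 3/2 * qU) * s ^ 2
        + 2 * t2 * s
        + Ham1 qU 0 qW pU pV pW t1 t2 t5 := by
    funext s
    simp only [Ham1]
    ring
  rw [DqV, h, deriv_quartic]
  ring

theorem DqW_Ham1 (qU qV qW pU pV pW t1 t2 t5 : ℝ) :
    DqW Ham1 qU qV qW pU pV pW t1 t2 t5
      = pU - 3/4 * qU * qW - 1/4 * t5 * qW := by
  have h : (fun s : ℝ => Ham1 qU qV s pU pV pW t1 t2 t5) = fun s =>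
      0 * s ^ 4 + 0 * s ^ 3 + (-(3/8) * qU - 1/8 * t5) * s ^ 2
        + pU * s
        + Ham1 qU qV 0 pU pV pW t1 t2 t5 := by
    funext s
    simp only [Ham1]
    ring
  rw [DqW, h, deriv_quartic]
  ring

theorem DpU_Ham1 (qU qV qW pU pV pW t1 t2 t5 : ℝ) :
    DpU Ham1 qU qV qW pU pV pW t1 t2 t5
      = qW := by
  have h : (fun s : ℝ => Ham1 qU qV qW s pV pW t1 t2 t5) = fun s =>
      0 * s ^ 4 + 0 * s ^ 3 + 0 * s ^ 2
        + qW * s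
        + Ham1 qU qV qW 0 pV pW t1 t2 t5 := by
    funext s
    simp only [Ham1]
    ring
  rw [DpU, h, deriv_quartic]
  ring

theorem DpV_Ham1 (qU qV qW pU pV pW t1 t2 t5 : ℝ) :
    DpV Ham1 qU qV qW pU pV pW t1 t2 t5
      = pV := by
  have h : (fun s : ℝ => Ham1 qU qV qW pU s pW t1 t2 t5) = fun s =>
      0 * s ^ 4 + 0 * s ^ 3 + 1/2 * s ^ 2
        + 0 * s
        + Ham1 qU qV qW pU 0 pW t1 t2 t5 := by
    funext s
    simp only [Ham1]
    ring
  rw [DpV, h, deriv_quartic]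
  ring

theorem DpW_Ham1 (qU qV qW pU pV pW t1 t2 t5 : ℝ) :
    DpW Ham1 qU qV qW pU pV pW t1 t2 t5
      = 12 * pW + 2 * t5 * qU - 2 * t5 ^ 2 := by
  have h : (fun s : ℝ => Ham1 qU qV qW pU pV s t1 t2 t5) = fun s =>
      0 * s ^ 4 + 0 * s ^ 3 + 6 * s ^ 2
        + (2 * t5 * qU - 2 * t5 ^ 2) * s
        + Ham1 qU qV qW pU pV 0 t1 t2 t5 := by
    funext s
    simp only [Ham1]
    ring
  rw [DpW, h, deriv_quartic]
  ring

theorem string_equation_hamiltonian_flow_t1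
    (U V : ℝ → ℝ → ℝ → ℝ)
    (hU : ContDiff ℝ (⊤ : ℕ∞) fun p : ℝ × ℝ × ℝ => U p.1 p.2.1 p.2.2)
    (hV : ContDiff ℝ (⊤ : ℕ∞) fun p : ℝ × ℝ × ℝ => V p.1 p.2.1 p.2.2)
    (hS1 : ∀ t5 t2 x : ℝ,
      0 = (1/2) * deriv^[2] (V t5 t2) x - (3/2) * U t5 t2 x * V t5 t2 x
        + (5/2) * t5 * V t5 t2 x + t2)
    (hS2 : ∀ t5 t2 x : ℝ,
      0 = (1/12) * deriv^[4] (U t5 t2) x - (3/4) * deriv^[2] (U t5 t2) x * U t5 t2 x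
        - (3/8) * (deriv (U t5 t2) x) ^ 2 + (3/2) * (V t5 t2 x) ^ 2 + (1/2) * (U t5 t2 x) ^ 3
        - (5/12) * t5 * (3 * (U t5 t2 x) ^ 2 - deriv^[2] (U t5 t2) x) + x)
    (hF1 : ∀ t5 t2 x : ℝ, deriv (fun s => U t5 s x) t2 = -2 * deriv (V t5 t2) x)
    (hF2 : ∀ t5 t2 x : ℝ,
      deriv (fun s => V t5 s x) t2 = (1/6) * deriv^[3] (U t5 t2) x - U t5 t2 x * deriv (U t5 t2) x)
    (hF3 : ∀ t5 t2 x : ℝ,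
      deriv (fun s => U s t2 x) t5
        = deriv (fun y => -(1/6) * U t5 t2 y * deriv^[2] (U t5 t2) y
            + (1/8) * (deriv (U t5 t2) y) ^ 2 + (1/4) * (U t5 t2 y) ^ 3
            - (1/2) * (V t5 t2 y) ^ 2
            - (5/9) * t5 * (3 * (U t5 t2 y) ^ 2 - deriv^[2] (U t5 t2) y) + (4/3) * y) x)
    (hF4 : ∀ t5 t2 x : ℝ,
      deriv (fun s => V s t2 x) t5
        = deriv (fun y => (1/12) * deriv^[2] (U t5 t2) y * V t5 t2 y
            - (1/4) * deriv (U t5 t2) y * deriv (V t5 t2) y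
            + (5/16) * (U t5 t2 y) ^ 2 * V t5 t2 y
            - ((5/3) * t5 + (1/4) * U t5 t2 y) ^ 2 * V t5 t2 y - t2 * U t5 t2 y) x) :
    ∀ t5 t2 x : ℝ,
      deriv (fun y => QUc U t5 t2 y) x
        = DpU Ham1 (QUc U t5 t2 x) (QVc V t5 t2 x) (QWc U t5 t2 x) (PUc U t5 t2 x) (PVc V t5 t2 x) (PWc U t5 t2 x) x t2 t5
      ∧ deriv (fun y => QVc V t5 t2 y) x
        = DpV Ham1 (QUc U t5 t2 x) (QVc V t5 t2 x) (QWc U t5 t2 x) (PUc U t5 t2 x) (PVc V t5 t2 x) (PWc U t5 t2 x) x t2 t5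
      ∧ deriv (fun y => QWc U t5 t2 y) x
        = DpW Ham1 (QUc U t5 t2 x) (QVc V t5 t2 x) (QWc U t5 t2 x) (PUc U t5 t2 x) (PVc V t5 t2 x) (PWc U t5 t2 x) x t2 t5
      ∧ deriv (fun y => PUc U t5 t2 y) x
        = - (DqU Ham1 (QUc U t5 t2 x) (QVc V t5 t2 x) (QWc U t5 t2 x) (PUc U t5 t2 x) (PVc V t5 t2 x) (PWc U t5 t2 x) x t2 t5)
      ∧ deriv (fun y => PVc V t5 t2 y) x
        = - (DqV Ham1 (QUc U t5 t2 x) (QVc V t5 t2 x) (QWc U t5 t2 x) (PUc U t5 t2 x) (PVc V t5 t2 x) (PWc U t5 t2 x) x t2 t5)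
      ∧ deriv (fun y => PWc U t5 t2 y) x
        = - (DqW Ham1 (QUc U t5 t2 x) (QVc V t5 t2 x) (QWc U t5 t2 x) (PUc U t5 t2 x) (PVc V t5 t2 x) (PWc U t5 t2 x) x t2 t5) := by
  intro t5 t2 x
  have hu : ContDiff ℝ (⊤ : ℕ∞) (U t5 t2) :=
    hU.comp (contDiff_const.prodMk (contDiff_const.prodMk contDiff_id))
  have hv : ContDiff ℝ (⊤ : ℕ∞) (V t5 t2) :=
    hV.comp (contDiff_const.prodMk (contDiff_const.prodMk contDiff_id))
  have u0 : HasDerivAt (U t5 t2) (deriv (U t5 t2) x) x := hasDerivAt_iterate_deriv hu 0 x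
  have u1 : HasDerivAt (deriv (U t5 t2)) (deriv^[2] (U t5 t2) x) x :=
    hasDerivAt_iterate_deriv hu 1 x
  have u2 := hasDerivAt_iterate_deriv hu 2 x
  have u3 := hasDerivAt_iterate_deriv hu 3 x
  have v1 : HasDerivAt (deriv (V t5 t2)) (deriv^[2] (V t5 t2) x) x :=
    hasDerivAt_iterate_deriv hv 1 x
  have hPU : HasDerivAt (fun y => PUc U t5 t2 y) _ x :=
    ((((u0.const_mul 3).mul u1).sub (u3.const_mul (1/3))).sub
      (u1.const_mul (7/3 * t5))).const_mul (1/4)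
  have hPW : HasDerivAt (fun y => PWc U t5 t2 y) _ x :=
    ((u2.const_mul (1/12)).sub (u0.const_mul (1/6 * t5))).add_const (7/18 * t5 ^ 2)
  refine ⟨?_, ?_, ?_, ?_, ?_, ?_⟩
  · rw [DpU_Ham1]
    exact (u0.sub_const (4/3 * t5)).deriv
  · rw [DpV_Ham1]
    rfl
  · rw [DpW_Ham1]
    refine u1.deriv.trans ?_
    simp only [PWc, QUc]
    ring
  · rw [DqU_Ham1, hPU.deriv]
    simp only [PWc, QUc, QVc, QWc]
    linear_combination hS2 t5 t2 x
  · rw [DqV_Ham1]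
    refine v1.deriv.trans ?_
    simp only [QUc, QVc]
    linear_combination -2 * hS1 t5 t2 x
  · rw [DqW_Ham1, hPW.deriv]
    simp only [PUc, QUc, QWc]
    ring
end

section
/- Fix any values (Q_U,Q_V,Q_W,P_U,P_V,P_W,t₁,t₂,t₅) ∈ ℂ⁹. Then there exist 3×3 complex matrices 𝓛₀, 𝓛₁, 𝓛₂, 𝓛₃, 𝓛₄ such that for every ξ ∈ ℂ∖{0}: 𝓛(ξ) = 3·diag(1, ω, ω²)·ξ⁶ + 𝓛₄ξ⁴ + 𝓛₃ξ³ + 𝓛₂ξ² + 𝓛₁ξ + 𝓛₀ + ξ⁻¹·(i/√3)·[[0, −1, 1],[1, 0, −1],[−1, 1, 0]]. In particular, 𝓛(ξ) has no ξ⁵ term, its leading term at infinity is the diagonal matrix 3·diag(1,ω,ω²)ξ⁶, and it has a simple pole at ξ = 0 with the stated nilpotent-free resonant residue. -/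
noncomputable def Lmat {K : Type*} [Field K] (qU qV qW pU pV pW t1 t2 t5 lam : K) :
    Matrix (Fin 3) (Fin 3) K :=
  !![(1/8) * qU ^ 2 - pW + (1/2) * pV - (1/4) * t5 * qU - (1/6) * t5 ^ 2,
     (2 * t5 + (1/4) * qU) * lam
       + ((5/16) * qU * qW - pU + (1/4) * t5 * qW - (3/8) * qU * qV - (1/2) * t5 * qV + t2),
     lam ^ 2 - qV * lam
       + ((1/16) * qW ^ 2 + (7/32) * qU ^ 3 + (3/4) * qV ^ 2 - (3/2) * pW * qU
          + (5/16) * t5 * qU ^ 2 - 2 * t5 * pW + (1/4) * t5 ^ 2 * qU + t1 + (8/27) * t5 ^ 3);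
     lam + (1/2) * qV - (1/4) * qW,
     2 * pW - (1/4) * qU ^ 2 + (1/2) * t5 * qU + (1/3) * t5 ^ 2,
     (2 * t5 + (1/4) * qU) * lam
       + (-(5/16) * qU * qW + pU - (1/4) * t5 * qW - (3/8) * qU * qV - (1/2) * t5 * qV + t2);
     t5 - (1/2) * qU,
     lam + (1/2) * qV + (1/4) * qW,
     (1/8) * qU ^ 2 - pW - (1/2) * pV - (1/4) * t5 * qU - (1/6) * t5 ^ 2]

noncomputable def omg : ℂ := Complex.exp (2 * Real.pi * Complex.I / 3)

noncomputable def Umat : Matrix (Fin 3) (Fin 3) ℂ :=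
  (Complex.I / (Real.sqrt 3 : ℂ)) • !![1, omg, omg ^ 2; 1, 1, 1; 1, omg ^ 2, omg]

noncomputable def ghat (ξ : ℂ) : Matrix (Fin 3) (Fin 3) ℂ :=
  Matrix.diagonal ![ξ, 1, ξ⁻¹] * Umat

/-- The entrywise derivative `dĝ/dξ`. -/
noncomputable def ghatDeriv (ξ : ℂ) : Matrix (Fin 3) (Fin 3) ℂ :=
  Matrix.of fun i j => deriv (fun z => ghat z i j) ξ

noncomputable def calL (qU qV qW pU pV pW t1 t2 t5 : ℂ) (ξ : ℂ) :
    Matrix (Fin 3) (Fin 3) ℂ :=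
  (3 * ξ ^ 2) • ((ghat ξ)⁻¹ * Lmat qU qV qW pU pV pW t1 t2 t5 (ξ ^ 3) * ghat ξ)
    - (ghat ξ)⁻¹ * ghatDeriv ξ

noncomputable def Smat : Matrix (Fin 3) (Fin 3) ℂ := !![0, 1, 0; 0, 0, 1; 1, 0, 0]

theorem omg_eq : omg = -1 / 2 + (Real.sqrt 3 : ℂ) / 2 * Complex.I := by
  have h : (2 * Real.pi * Complex.I / 3 : ℂ) = ((Real.pi - Real.pi / 3 : ℝ) : ℂ) * Complex.I := by
    push_cast; ring
  rw [omg, h, Complex.exp_mul_I, ← Complex.ofReal_cos, ← Complex.ofReal_sin, Real.cos_pi_sub,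
    Real.sin_pi_sub, Real.cos_pi_div_three, Real.sin_pi_div_three]
  push_cast; ring

theorem ofReal_sqrt_three_sq : (Real.sqrt 3 : ℂ) ^ 2 = 3 := by
  rw [← Complex.ofReal_pow, Real.sq_sqrt (by norm_num)]; norm_num

theorem ofReal_sqrt_three_ne_zero : (Real.sqrt 3 : ℂ) ≠ 0 := by
  intro h
  have := ofReal_sqrt_three_sq
  rw [h] at this; norm_num at this

theorem omg_sq : omg ^ 2 = -1 - omg := by
  rw [omg_eq]
  linear_combination (Complex.I ^ 2 / 4) * ofReal_sqrt_three_sq + (3 / 4) * Complex.I_sq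

theorem I_div_sqrt_three : Complex.I / (Real.sqrt 3 : ℂ) = (1 + 2 * omg) / 3 := by
  rw [omg_eq, div_eq_iff ofReal_sqrt_three_ne_zero]
  linear_combination (-Complex.I / 3) * ofReal_sqrt_three_sq

/-- The inverse of `Umat`. -/
noncomputable def UmatInv : Matrix (Fin 3) (Fin 3) ℂ :=
  (-(Complex.I / (Real.sqrt 3 : ℂ))) • !![1, 1, 1; omg ^ 2, 1, omg; omg, 1, omg ^ 2]

theorem UmatInv_mul_Umat : UmatInv * Umat = 1 := by
  have h := omg_sq
  rw [UmatInv, Umat, I_div_sqrt_three]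
  ext i j
  fin_cases i <;> fin_cases j <;>
    simp [Matrix.mul_apply, Fin.sum_univ_three] <;> grind

theorem ghat_inv {ξ : ℂ} (hξ : ξ ≠ 0) :
    (ghat ξ)⁻¹ = UmatInv * Matrix.diagonal ![ξ⁻¹, 1, ξ] := by
  have hD : Matrix.diagonal ![ξ⁻¹, 1, ξ] * Matrix.diagonal ![ξ, 1, ξ⁻¹] = 1 := by
    rw [Matrix.diagonal_mul_diagonal, ← Matrix.diagonal_one]
    congr 1
    ext i
    fin_cases i <;> simp [hξ]
  apply Matrix.inv_eq_left_inv
  rw [ghat, Matrix.mul_assoc, ← Matrix.mul_assoc _ _ Umat, hD, Matrix.one_mul, UmatInv_mul_Umat]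

theorem ghatDeriv_eq (ξ : ℂ) :
    ghatDeriv ξ = Matrix.diagonal ![1, 0, -(ξ ^ 2)⁻¹] * Umat := by
  ext i j
  fin_cases i <;> simp [ghatDeriv, ghat, Matrix.diagonal_mul]

theorem UmatInv_mul_cyclic_mul_Umat :
    UmatInv * !![0, 0, 1; 1, 0, 0; 0, 1, 0] * Umat = Matrix.diagonal ![1, omg, omg ^ 2] := by
  have h := omg_sq
  rw [UmatInv, Umat, I_div_sqrt_three]
  ext i j
  fin_cases i <;> fin_cases j <;>
    simp [Matrix.mul_apply, Fin.sum_univ_three] <;> grind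

theorem UmatInv_mul_diagonal_mul_Umat :
    UmatInv * Matrix.diagonal ![-1, 0, 1] * Umat
      = (Complex.I / (Real.sqrt 3 : ℂ)) • !![0, -1, 1; 1, 0, -1; -1, 1, 0] := by
  have h := omg_sq
  rw [UmatInv, Umat, I_div_sqrt_three]
  ext i j
  fin_cases i <;> fin_cases j <;>
    rw [Matrix.mul_apply] <;>
    simp [Matrix.mul_diagonal, Fin.sum_univ_three] <;> grind

theorem diagonal_mul_Lmat_mul_diagonal (qU qV qW pU pV pW t1 t2 t5 : ℂ)
    {a : Matrix (Fin 3) (Fin 3) ℂ} (ha : a = Lmat qU qV qW pU pV pW t1 t2 t5 0)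
    {ξ : ℂ} (hξ : ξ ≠ 0) :
    (3 * ξ ^ 2) • (Matrix.diagonal ![ξ⁻¹, 1, ξ] * Lmat qU qV qW pU pV pW t1 t2 t5 (ξ ^ 3)
        * Matrix.diagonal ![ξ, 1, ξ⁻¹])
      = (3 * ξ ^ 6) • !![0, 0, 1; 1, 0, 0; 0, 1, 0]
        + ξ ^ 4 • !![0, 3 * (2 * t5 + (1/4) * qU), 0; 0, 0, 3 * (2 * t5 + (1/4) * qU);
            3 * a 2 0, 0, 0]
        + ξ ^ 3 • !![0, 0, -(3 * qV); 3 * a 1 0, 0, 0; 0, 3 * a 2 1, 0]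
        + ξ ^ 2 • Matrix.diagonal ![3 * a 0 0, 3 * a 1 1, 3 * a 2 2]
        + ξ • !![0, 3 * a 0 1, 0; 0, 0, 3 * a 1 2; 0, 0, 0]
        + !![0, 0, 3 * a 0 2; 0, 0, 0; 0, 0, 0] := by
  subst ha
  ext i j
  rw [Matrix.smul_apply, Matrix.mul_diagonal, Matrix.diagonal_mul]
  fin_cases i <;> fin_cases j <;> (simp [Lmat]; field_simp; try ring)

/-- `calL` is the conjugate by `Umat` of a matrix with Laurent monomials as coefficients. -/
theorem calL_eq_conj (qU qV qW pU pV pW t1 t2 t5 : ℂ) {ξ : ℂ} (hξ : ξ ≠ 0) :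
    calL qU qV qW pU pV pW t1 t2 t5 ξ = UmatInv *
      ((3 * ξ ^ 2) • (Matrix.diagonal ![ξ⁻¹, 1, ξ] * Lmat qU qV qW pU pV pW t1 t2 t5 (ξ ^ 3)
          * Matrix.diagonal ![ξ, 1, ξ⁻¹])
        + ξ⁻¹ • Matrix.diagonal ![-1, 0, 1]) * Umat := by
  have hD : Matrix.diagonal ![ξ⁻¹, 1, ξ] * Matrix.diagonal ![1, 0, -(ξ ^ 2)⁻¹]
      = -(ξ⁻¹ • Matrix.diagonal ![-1, 0, 1]) := by
    rw [Matrix.diagonal_mul_diagonal, ← Matrix.diagonal_smul, Matrix.diagonal_neg]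
    congr 1
    ext i
    fin_cases i <;> simp <;> field_simp
  have hres : UmatInv * Matrix.diagonal ![ξ⁻¹, 1, ξ]
      * (Matrix.diagonal ![1, 0, -(ξ ^ 2)⁻¹] * Umat)
      = -(UmatInv * (ξ⁻¹ • Matrix.diagonal ![-1, 0, 1]) * Umat) := by
    rw [Matrix.mul_assoc, ← Matrix.mul_assoc _ _ Umat, hD, Matrix.neg_mul, Matrix.mul_neg,
      Matrix.mul_assoc]
  rw [calL, ghat_inv hξ, ghatDeriv_eq ξ, hres, sub_neg_eq_add, Matrix.mul_add, Matrix.add_mul,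
    ghat]
  simp only [Matrix.mul_smul, Matrix.smul_mul, Matrix.mul_assoc]

theorem calL_laurent_structure (qU qV qW pU pV pW t1 t2 t5 : ℂ) :
    ∃ L0 L1 L2 L3 L4 : Matrix (Fin 3) (Fin 3) ℂ, ∀ ξ : ℂ, ξ ≠ 0 →
      calL qU qV qW pU pV pW t1 t2 t5 ξ
        = (3 * ξ ^ 6) • Matrix.diagonal ![1, omg, omg ^ 2]
          + ξ ^ 4 • L4 + ξ ^ 3 • L3 + ξ ^ 2 • L2 + ξ • L1 + L0
          + ξ⁻¹ • ((Complex.I / (Real.sqrt 3 : ℂ)) • !![0, -1, 1; 1, 0, -1; -1, 1, 0]) := by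
  set a := Lmat qU qV qW pU pV pW t1 t2 t5 0 with ha
  refine ⟨UmatInv * !![0, 0, 3 * a 0 2; 0, 0, 0; 0, 0, 0] * Umat,
    UmatInv * !![0, 3 * a 0 1, 0; 0, 0, 3 * a 1 2; 0, 0, 0] * Umat,
    UmatInv * Matrix.diagonal ![3 * a 0 0, 3 * a 1 1, 3 * a 2 2] * Umat,
    UmatInv * !![0, 0, -(3 * qV); 3 * a 1 0, 0, 0; 0, 3 * a 2 1, 0] * Umat,
    UmatInv * !![0, 3 * (2 * t5 + (1/4) * qU), 0; 0, 0, 3 * (2 * t5 + (1/4) * qU);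
      3 * a 2 0, 0, 0] * Umat, fun ξ hξ => ?_⟩
  rw [calL_eq_conj _ _ _ _ _ _ _ _ _ hξ, ← UmatInv_mul_cyclic_mul_Umat,
    ← UmatInv_mul_diagonal_mul_Umat, diagonal_mul_Lmat_mul_diagonal _ _ _ _ _ _ _ _ _ ha hξ]
  simp only [Matrix.mul_add, Matrix.add_mul, Matrix.mul_smul, Matrix.smul_mul]
end

section
/- Fix t₅, t₂ ∈ ℝ and let U, V : ℝ → ℝ be smooth functions of x. Then the zero-curvature equation ∂𝒫/∂x − ∂𝒬/∂λ + 𝒫𝒬 − 𝒬𝒫 = 0 holds for every λ if and only if U and V satisfy the (3,4) string equation: (S1) 0 = (1/2)V'' − (3/2)U·V + (5/2)t₅·V + t₂ and (S2) 0 = (1/12)U'''' − (3/4)U''·U − (3/8)(U')² + (3/2)V² + (1/2)U³ − (5/12)t₅·(3U² − U'') + x. -/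
/-- The matrix `𝒫(λ)`: `L(λ)` with the Darboux coordinates of `(U,V)` substituted. -/
noncomputable def Pmat (t5 t2 : ℝ) (U V : ℝ → ℝ) (lam x : ℝ) : Matrix (Fin 3) (Fin 3) ℝ :=
  Lmat (U x - (4/3) * t5) (V x) (deriv U x)
    ((1/4) * (3 * U x * deriv U x - (1/3) * deriv^[3] U x - (7/3) * t5 * deriv U x))
    (deriv V x) ((1/12) * deriv^[2] U x - (1/6) * t5 * U x + (7/18) * t5 ^ 2)
    x t2 t5 lam

noncomputable def Qmat (U V : ℝ → ℝ) (lam x : ℝ) : Matrix (Fin 3) (Fin 3) ℝ :=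
  !![0, (3/4) * U x, lam - (3/2) * V x;
     1, 0, (3/4) * U x;
     0, 1, 0]

/-- Left-hand side of the first component of the `(3,4)` string equation. -/
noncomputable def stringS1 (t5 t2 : ℝ) (U V : ℝ → ℝ) (x : ℝ) : ℝ :=
  (1/2) * deriv^[2] V x - (3/2) * U x * V x + (5/2) * t5 * V x + t2

/-- Left-hand side of the second component of the `(3,4)` string equation. -/
noncomputable def stringS2 (t5 : ℝ) (U V : ℝ → ℝ) (x : ℝ) : ℝ :=
  (1/12) * deriv^[4] U x - (3/4) * deriv^[2] U x * U x
    - (3/8) * (deriv U x) ^ 2 + (3/2) * (V x) ^ 2 + (1/2) * (U x) ^ 3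
    - (5/12) * t5 * (3 * (U x) ^ 2 - deriv^[2] U x) + x

theorem curvature_eq_string (t5 t2 : ℝ) (U V : ℝ → ℝ)
    (hU : ContDiff ℝ (⊤ : ℕ∞) U) (hV : ContDiff ℝ (⊤ : ℕ∞) V) (lam x : ℝ) :
    (Matrix.of fun i j => deriv (fun y => Pmat t5 t2 U V lam y i j) x)
        - (Matrix.of fun i j => deriv (fun m => Qmat U V m x i j) lam)
        + Pmat t5 t2 U V lam x * Qmat U V lam x
        - Qmat U V lam x * Pmat t5 t2 U V lam x
      = !![stringS1 t5 t2 U V x, stringS2 t5 U V x, 0;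
           0, 0, -stringS2 t5 U V x;
           0, 0, -stringS1 t5 t2 U V x] := by
  have differentiable_iterate (f : ℝ → ℝ) (hf : ContDiff ℝ (⊤ : ℕ∞) f) (n : ℕ) :
      Differentiable ℝ (deriv^[n] f) :=
    (hf.iterate_deriv n).differentiable (by simp)
  have hU0 := differentiable_iterate U hU 0
  have hU1 := differentiable_iterate U hU 1
  have hU2 := differentiable_iterate U hU 2
  have hU3 := differentiable_iterate U hU 3
  have hV0 := differentiable_iterate V hV 0
  have hV1 := differentiable_iterate V hV 1
  simp only [stringS1, stringS2, Function.iterate_succ, Function.iterate_zero,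
    Function.comp, id] at *
  ext i j
  simp only [Matrix.sub_apply, Matrix.add_apply, Matrix.of_apply, Matrix.mul_apply,
    Fin.sum_univ_three]
  fin_cases i <;> fin_cases j <;> simp [Pmat, Qmat, Lmat] <;>
    (try simp (disch := fun_prop) only [deriv_fun_add, deriv_fun_sub, deriv_fun_mul,
      deriv_fun_pow, deriv_const, deriv.fun_neg, deriv_id'']) <;>
    (try push_cast) <;> ring

theorem zero_curvature_iff_string_equation (t5 t2 : ℝ) (U V : ℝ → ℝ)
    (hU : ContDiff ℝ (⊤ : ℕ∞) U) (hV : ContDiff ℝ (⊤ : ℕ∞) V) :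
    (∀ lam x : ℝ,
        (Matrix.of fun i j => deriv (fun y => Pmat t5 t2 U V lam y i j) x)
          - (Matrix.of fun i j => deriv (fun m => Qmat U V m x i j) lam)
          + Pmat t5 t2 U V lam x * Qmat U V lam x
          - Qmat U V lam x * Pmat t5 t2 U V lam x = 0)
    ↔ (∀ x : ℝ,
        0 = (1/2) * deriv^[2] V x - (3/2) * U x * V x + (5/2) * t5 * V x + t2
        ∧ 0 = (1/12) * deriv^[4] U x - (3/4) * deriv^[2] U x * U x
            - (3/8) * (deriv U x) ^ 2 + (3/2) * (V x) ^ 2 + (1/2) * (U x) ^ 3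
            - (5/12) * t5 * (3 * (U x) ^ 2 - deriv^[2] U x) + x) := by
  simp only [curvature_eq_string t5 t2 U V hU hV]
  constructor
  · intro h x
    have h1 : stringS1 t5 t2 U V x = 0 := congrFun (congrFun (h 0 x) 0) 0
    have h2 : stringS2 t5 U V x = 0 := congrFun (congrFun (h 0 x) 0) 1
    exact ⟨h1.symm, h2.symm⟩
  · intro h lam x
    have h1 : stringS1 t5 t2 U V x = 0 := (h x).1.symm
    have h2 : stringS2 t5 U V x = 0 := (h x).2.symm
    ext i j
    fin_cases i <;> fin_cases j <;> simp [h1, h2]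
end

section
/- Fix t₅ ∈ ℝ and let U, V : ℝ² → ℝ be smooth functions of (t₂, x). Then the zero-curvature equation ∂𝒬/∂t₂ − ∂M/∂x + 𝒬M − M𝒬 = 0 holds identically in λ if and only if U and V satisfy the Boussinesq-type flow equations (F1) ∂U/∂t₂ = −2V' and (F2) ∂V/∂t₂ = (1/6)U''' − U·U'. -/
noncomputable def Qmat2 (U V : ℝ → ℝ → ℝ) (t2 x lam : ℝ) : Matrix (Fin 3) (Fin 3) ℝ :=
  !![0, (3/4) * U t2 x, lam - (3/2) * V t2 x;
     1, 0, (3/4) * U t2 x;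
     0, 1, 0]

noncomputable def Mmat2 (U V : ℝ → ℝ → ℝ) (t2 x lam : ℝ) : Matrix (Fin 3) (Fin 3) ℝ :=
  !![-(1/4) * U t2 x,
     lam + (1/4) * deriv (U t2) x - (3/2) * V t2 x,
     (9/16) * (U t2 x) ^ 2 - (1/4) * deriv^[2] (U t2) x;
     0, (1/2) * U t2 x, lam - (1/4) * deriv (U t2) x - (3/2) * V t2 x;
     1, 0, -(1/4) * U t2 x]

theorem contDiff_slice {U : ℝ → ℝ → ℝ}
    (hU : ContDiff ℝ (⊤ : ℕ∞) fun p : ℝ × ℝ => U p.1 p.2) (t : ℝ) :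
    ContDiff ℝ (⊤ : ℕ∞) (U t) :=
  hU.comp (contDiff_const.prodMk contDiff_id)

theorem contDiff_deriv {f : ℝ → ℝ} (hf : ContDiff ℝ (⊤ : ℕ∞) f) :
    ContDiff ℝ (⊤ : ℕ∞) (deriv f) :=
  (contDiff_infty_iff_deriv.1 hf).2

theorem deriv_Qmat2 (U V : ℝ → ℝ → ℝ) (t x lam : ℝ) :
    (Matrix.of fun i j => deriv (fun s => Qmat2 U V s x lam i j) t) =
      !![0, (3/4) * deriv (fun s => U s x) t, -(3/2) * deriv (fun s => V s x) t;
         0, 0, (3/4) * deriv (fun s => U s x) t;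
         0, 0, 0] := by
  ext i j
  fin_cases i <;> fin_cases j <;> simp [Qmat2]

theorem deriv_Mmat2 {U V : ℝ → ℝ → ℝ} {t : ℝ}
    (hU : ContDiff ℝ (⊤ : ℕ∞) (U t)) (hV : Differentiable ℝ (V t)) (x lam : ℝ) :
    (Matrix.of fun i j => deriv (fun y => Mmat2 U V t y lam i j) x) =
      !![-(1/4) * deriv (U t) x, (1/4) * deriv^[2] (U t) x - (3/2) * deriv (V t) x,
           (9/8) * U t x * deriv (U t) x - (1/4) * deriv^[3] (U t) x;
         0, (1/2) * deriv (U t) x, -(1/4) * deriv^[2] (U t) x - (3/2) * deriv (V t) x;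
         0, 0, -(1/4) * deriv (U t) x] := by
  have h0 : HasDerivAt (U t) (deriv (U t) x) x :=
    (hU.differentiable (by simp) x).hasDerivAt
  have h1 : HasDerivAt (deriv (U t)) (deriv^[2] (U t) x) x :=
    ((contDiff_deriv hU).differentiable (by simp) x).hasDerivAt
  have h2 : HasDerivAt (deriv^[2] (U t)) (deriv^[3] (U t) x) x :=
    ((contDiff_deriv (contDiff_deriv hU)).differentiable (by simp) x).hasDerivAt
  have hV' : HasDerivAt (V t) (deriv (V t) x) x := (hV x).hasDerivAt
  have e01 := ((h1.const_mul (1/4)).const_add lam).sub (hV'.const_mul (3/2))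
  have e02 := ((h0.pow 2).const_mul (9/16)).sub (h2.const_mul (1/4))
  have e12 := ((h1.const_mul (1/4)).const_sub lam).sub (hV'.const_mul (3/2))
  ext i j
  fin_cases i <;> fin_cases j
  · exact (h0.const_mul (-(1/4))).deriv
  · exact e01.deriv
  · refine e02.deriv.trans ?_
    simp
    ring
  · exact deriv_const x _
  · exact (h0.const_mul (1/2)).deriv
  · refine e12.deriv.trans ?_
    simp
  · exact deriv_const x _
  · exact deriv_const x _
  · exact (h0.const_mul (-(1/4))).deriv

theorem zero_curvature_eq {U V : ℝ → ℝ → ℝ}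
    (hU : ContDiff ℝ (⊤ : ℕ∞) fun p : ℝ × ℝ => U p.1 p.2)
    (hV : ContDiff ℝ (⊤ : ℕ∞) fun p : ℝ × ℝ => V p.1 p.2) (t x lam : ℝ) :
    (Matrix.of fun i j => deriv (fun s => Qmat2 U V s x lam i j) t)
        - (Matrix.of fun i j => deriv (fun y => Mmat2 U V t y lam i j) x)
        + Qmat2 U V t x lam * Mmat2 U V t x lam
        - Mmat2 U V t x lam * Qmat2 U V t x lam =
      !![0, (3/4) * (deriv (fun s => U s x) t + 2 * deriv (V t) x),
           -(3/2) * (deriv (fun s => V s x) t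
             - ((1/6) * deriv^[3] (U t) x - U t x * deriv (U t) x));
         0, 0, (3/4) * (deriv (fun s => U s x) t + 2 * deriv (V t) x);
         0, 0, 0] := by
  rw [deriv_Qmat2,
    deriv_Mmat2 (contDiff_slice hU t) ((contDiff_slice hV t).differentiable (by simp))]
  ext i j
  fin_cases i <;> fin_cases j <;>
    simp [Qmat2, Mmat2] <;> ring

theorem zero_curvature_QM_iff_boussinesq_flow (U V : ℝ → ℝ → ℝ)
    (hU : ContDiff ℝ (⊤ : ℕ∞) fun p : ℝ × ℝ => U p.1 p.2)
    (hV : ContDiff ℝ (⊤ : ℕ∞) fun p : ℝ × ℝ => V p.1 p.2) :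
    (∀ t2 x lam : ℝ,
        (Matrix.of fun i j => deriv (fun s => Qmat2 U V s x lam i j) t2)
          - (Matrix.of fun i j => deriv (fun y => Mmat2 U V t2 y lam i j) x)
          + Qmat2 U V t2 x lam * Mmat2 U V t2 x lam
          - Mmat2 U V t2 x lam * Qmat2 U V t2 x lam = 0)
    ↔ (∀ t2 x : ℝ,
        deriv (fun s => U s x) t2 = -2 * deriv (V t2) x
        ∧ deriv (fun s => V s x) t2 = (1/6) * deriv^[3] (U t2) x - U t2 x * deriv (U t2) x) := by
  simp only [zero_curvature_eq hU hV]
  refine forall₂_congr fun t x => ⟨fun h => ?_, fun ⟨h1, h2⟩ lam => ?_⟩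
  · have h01 := congrFun₂ (h 0) 0 1
    have h02 := congrFun₂ (h 0) 0 2
    simp only [Matrix.of_apply, Matrix.cons_val, Matrix.zero_apply] at h01 h02
    exact ⟨by linarith, by linarith⟩
  · rw [h1, h2]
    ext i j
    fin_cases i <;> fin_cases j <;> simp
end

section
/- Let n ≥ 1 and q ≥ 1 be integers, D = diag(d₁,…,d_n) a diagonal matrix with integer entries, and 𝒰 an invertible n×n complex matrix. For ζ ≠ 0 set g(ζ) := diag(ζ^{d₁},…,ζ^{d_n})·𝒰. Let A, B, C be n×n matrices whose entries are polynomials in one variable, and define the matrices of Laurent polynomials Â(ζ) := g(ζ)⁻¹·(q·ζ^{q−1}·A(ζ^q))·g(ζ) − g(ζ)⁻¹·g'(ζ), B̂(ζ) := g(ζ)⁻¹·B(ζ^q)·g(ζ), Ĉ(ζ) := g(ζ)⁻¹·C(ζ^q)·g(ζ). Then the coefficient of ζ⁻¹ in the Laurent polynomial tr( Â(ζ)·(B̂(ζ)Ĉ(ζ) − Ĉ(ζ)B̂(ζ)) + Ĉ'(ζ)·B̂(ζ) ) is zero, where Ĉ' denotes the derivative of Ĉ with respect to ζ. (This is the key residue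 identity underlying the closedness of the modified Jimbo–Miwa–Ueno τ-differential for non-diagonalizable polynomial connections, stated for integer-exponent gauge matrices.) -/
/-- The gauge matrix `g(ζ) = diag(ζ^{d₁},…,ζ^{dₙ})·𝒰`. -/
noncomputable def gmat (n : ℕ) (d : Fin n → ℤ) (U : Matrix (Fin n) (Fin n) ℂ) (ζ : ℂ) :
    Matrix (Fin n) (Fin n) ℂ :=
  Matrix.diagonal (fun i => ζ ^ d i) * U

/-- The entrywise derivative `g'(ζ)`. -/
noncomputable def gmatDeriv (n : ℕ) (d : Fin n → ℤ) (U : Matrix (Fin n) (Fin n) ℂ) (ζ : ℂ) :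
    Matrix (Fin n) (Fin n) ℂ :=
  Matrix.of fun i j => deriv (fun z => gmat n d U z i j) ζ

/-- `X̂(ζ) := g(ζ)⁻¹ · X(ζ^q) · g(ζ)` for a matrix `X` of polynomials. -/
noncomputable def hatConj (n : ℕ) (d : Fin n → ℤ) (U : Matrix (Fin n) (Fin n) ℂ) (q : ℕ)
    (X : Matrix (Fin n) (Fin n) (Polynomial ℂ)) (ζ : ℂ) : Matrix (Fin n) (Fin n) ℂ :=
  (gmat n d U ζ)⁻¹ * X.map (Polynomial.eval (ζ ^ q)) * gmat n d U ζ

/-- `Â(ζ) := g(ζ)⁻¹ · (q ζ^{q-1} A(ζ^q)) · g(ζ) − g(ζ)⁻¹·g'(ζ)`. -/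
noncomputable def hatA (n : ℕ) (d : Fin n → ℤ) (U : Matrix (Fin n) (Fin n) ℂ) (q : ℕ)
    (A : Matrix (Fin n) (Fin n) (Polynomial ℂ)) (ζ : ℂ) : Matrix (Fin n) (Fin n) ℂ :=
  (gmat n d U ζ)⁻¹ * (((q : ℂ) * ζ ^ (q - 1)) • A.map (Polynomial.eval (ζ ^ q))) * gmat n d U ζ
    - (gmat n d U ζ)⁻¹ * gmatDeriv n d U ζ

/-- The product rule for matrix-valued functions, entrywise. -/
theorem Matrix.hasDerivAt_mul_apply {n : ℕ} {M N : ℂ → Matrix (Fin n) (Fin n) ℂ}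
    {M' N' : Matrix (Fin n) (Fin n) ℂ} {z : ℂ}
    (hM : ∀ i j, HasDerivAt (fun w => M w i j) (M' i j) z)
    (hN : ∀ i j, HasDerivAt (fun w => N w i j) (N' i j) z) (i j : Fin n) :
    HasDerivAt (fun w => (M w * N w) i j) ((M' * N z + M z * N') i j) z := by
  simp only [Matrix.mul_apply, Matrix.add_apply, ← Finset.sum_add_distrib]
  exact HasDerivAt.fun_sum fun k _ => (hM i k).mul (hN k j)

theorem gmat_isUnit_det {n : ℕ} (d : Fin n → ℤ) {U : Matrix (Fin n) (Fin n) ℂ} (hU : IsUnit U)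
    {z : ℂ} (hz : z ≠ 0) : IsUnit (gmat n d U z).det := by
  rw [gmat, Matrix.det_mul, Matrix.det_diagonal]
  refine IsUnit.mul ?_ ((Matrix.isUnit_iff_isUnit_det U).1 hU)
  exact isUnit_iff_ne_zero.2 (Finset.prod_ne_zero_iff.2 fun i _ => zpow_ne_zero _ hz)

theorem hasDerivAt_gmat {n : ℕ} (d : Fin n → ℤ) (U : Matrix (Fin n) (Fin n) ℂ)
    {z : ℂ} (hz : z ≠ 0) (i j : Fin n) :
    HasDerivAt (fun w => gmat n d U w i j) (gmatDeriv n d U z i j) z := by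
  refine DifferentiableAt.hasDerivAt ?_
  simp only [gmat, Matrix.diagonal_mul]
  exact ((hasDerivAt_zpow (d i) z (Or.inl hz)).differentiableAt).mul_const _

theorem hasDerivAt_gmat_inv {n : ℕ} (d : Fin n → ℤ) {U : Matrix (Fin n) (Fin n) ℂ}
    (hU : IsUnit U) {z : ℂ} (hz : z ≠ 0) (i j : Fin n) :
    HasDerivAt (fun w => (gmat n d U w)⁻¹ i j)
      ((-((gmat n d U z)⁻¹ * gmatDeriv n d U z * (gmat n d U z)⁻¹)) i j) z := by
  have hdiff : ∀ i j, DifferentiableAt ℂ (fun w => (gmat n d U w)⁻¹ i j) z := by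
    intro i j
    have hd : DifferentiableAt ℂ (fun w => U⁻¹ i j * w ^ (-d j)) z :=
      ((hasDerivAt_zpow (-d j) z (Or.inl hz)).differentiableAt).const_mul _
    refine hd.congr_of_eventuallyEq ?_
    filter_upwards [isOpen_ne.mem_nhds hz] with w hw
    have hinv : (gmat n d U w)⁻¹ = U⁻¹ * Matrix.diagonal (fun i => w ^ (-d i)) := by
      refine Matrix.inv_eq_left_inv ?_
      rw [gmat, Matrix.mul_assoc, ← Matrix.mul_assoc (Matrix.diagonal _),
        Matrix.diagonal_mul_diagonal]
      have h1 : (fun i => w ^ (-d i) * w ^ d i) = fun _ => (1 : ℂ) := by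
        funext i
        rw [← zpow_add₀ hw, neg_add_cancel, zpow_zero]
      rw [h1, Matrix.diagonal_one, Matrix.one_mul,
        Matrix.nonsing_inv_mul _ ((Matrix.isUnit_iff_isUnit_det U).1 hU)]
    rw [hinv, Matrix.mul_diagonal]
  set G' : Matrix (Fin n) (Fin n) ℂ :=
    Matrix.of fun i j => deriv (fun w => (gmat n d U w)⁻¹ i j) z
  have hG : ∀ i j, HasDerivAt (fun w => (gmat n d U w)⁻¹ i j) (G' i j) z :=
    fun i j => (hdiff i j).hasDerivAt
  have hzero : G' * gmat n d U z + (gmat n d U z)⁻¹ * gmatDeriv n d U z = 0 := by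
    ext i j
    refine (Matrix.hasDerivAt_mul_apply hG (hasDerivAt_gmat d U hz) i j).unique ?_
    refine (hasDerivAt_const z ((1 : Matrix (Fin n) (Fin n) ℂ) i j)).congr_of_eventuallyEq ?_
    filter_upwards [isOpen_ne.mem_nhds hz] with w hw
    rw [Matrix.nonsing_inv_mul _ (gmat_isUnit_det d hU hw)]
  have heq : G' = -((gmat n d U z)⁻¹ * gmatDeriv n d U z * (gmat n d U z)⁻¹) := by
    rw [← Matrix.neg_mul, ← eq_neg_of_add_eq_zero_left hzero, Matrix.mul_assoc,
      Matrix.mul_nonsing_inv _ (gmat_isUnit_det d hU hz), Matrix.mul_one]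
  rw [← heq]
  exact hG i j

theorem hasDerivAt_hatConj {n : ℕ} (d : Fin n → ℤ) {U : Matrix (Fin n) (Fin n) ℂ}
    (hU : IsUnit U) (q : ℕ) (X : Matrix (Fin n) (Fin n) (Polynomial ℂ)) {z : ℂ} (hz : z ≠ 0)
    (i j : Fin n) :
    HasDerivAt (fun w => hatConj n d U q X w i j)
      (((gmat n d U z)⁻¹ * (((q : ℂ) * z ^ (q - 1)) •
            (X.map Polynomial.derivative).map (Polynomial.eval (z ^ q))) * gmat n d U z
          + hatConj n d U q X z * ((gmat n d U z)⁻¹ * gmatDeriv n d U z)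
          - (gmat n d U z)⁻¹ * gmatDeriv n d U z * hatConj n d U q X z) i j) z := by
  have hX : ∀ i j, HasDerivAt (fun w => X.map (Polynomial.eval (w ^ q)) i j)
      ((((q : ℂ) * z ^ (q - 1)) •
        (X.map Polynomial.derivative).map (Polynomial.eval (z ^ q))) i j) z := by
    intro i j
    simp only [Matrix.map_apply, Matrix.smul_apply, smul_eq_mul]
    rw [mul_comm]
    exact ((X i j).hasDerivAt (z ^ q)).comp z (hasDerivAt_pow q z)
  have h := Matrix.hasDerivAt_mul_apply
    (Matrix.hasDerivAt_mul_apply (hasDerivAt_gmat_inv d hU hz) hX) (hasDerivAt_gmat d U hz) i j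
  unfold hatConj
  convert h using 2
  have hg := Matrix.mul_nonsing_inv _ (gmat_isUnit_det d hU hz)
  simp only [Matrix.add_mul, Matrix.neg_mul, Matrix.mul_assoc]
  rw [← Matrix.mul_assoc (gmat n d U z) (gmat n d U z)⁻¹, hg, Matrix.one_mul]
  refine congrFun (congrFun ?_ i) j
  abel

/-- Conjugation by `g` and the terms involving the logarithmic derivative `h` drop out of the
trace. -/
theorem Matrix.trace_gauge {n : ℕ} {R : Type*} [CommRing R]
    (g gi h A B C C' : Matrix (Fin n) (Fin n) R) (hg : g * gi = 1) :
    Matrix.trace ((gi * A * g - h) * (gi * B * g * (gi * C * g) - gi * C * g * (gi * B * g))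
        + (gi * C' * g + gi * C * g * h - h * (gi * C * g)) * (gi * B * g))
      = Matrix.trace (A * (B * C - C * B) + C' * B) := by
  have hmul : ∀ X Y : Matrix (Fin n) (Fin n) R,
      gi * X * g * (gi * Y * g) = gi * (X * Y) * g := by
    intro X Y
    simp only [Matrix.mul_assoc]
    rw [← Matrix.mul_assoc g gi, hg, Matrix.one_mul]
  have htr : ∀ X : Matrix (Fin n) (Fin n) R, Matrix.trace (gi * X * g) = Matrix.trace X := by
    intro X
    rw [Matrix.trace_mul_comm, ← Matrix.mul_assoc, hg, Matrix.one_mul]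
  have hcomm : Matrix.trace (gi * C * g * h * (gi * B * g))
      = Matrix.trace (h * (gi * (B * C) * g)) := by
    rw [Matrix.trace_mul_comm, ← Matrix.mul_assoc, hmul, Matrix.trace_mul_comm]
  have hassoc : h * (gi * C * g) * (gi * B * g) = h * (gi * (C * B) * g) := by
    rw [Matrix.mul_assoc, hmul]
  simp only [Matrix.sub_mul, Matrix.add_mul, Matrix.mul_sub, Matrix.trace_add, Matrix.trace_sub,
    hcomm, hassoc, hmul, htr]
  ring

/-- A polynomial, evaluated at nonzero points, is a Laurent polynomial without residue. -/
theorem Polynomial.exists_finsupp_eval_eq_sum_zpow (Q : Polynomial ℂ) :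
    ∃ f : ℤ →₀ ℂ, f (-1) = 0 ∧ ∀ z : ℂ, Q.eval z = ∑ k ∈ f.support, f k * z ^ k := by
  refine ⟨∑ k ∈ Finset.range (Q.natDegree + 1), Finsupp.single (k : ℤ) (Q.coeff k), ?_, ?_⟩
  · rw [Finsupp.finsetSum_apply]
    exact Finset.sum_eq_zero fun k _ => Finsupp.single_eq_of_ne (by omega)
  · intro z
    change _ = Finsupp.sum _ fun k a => a * z ^ k
    rw [← Finsupp.sum_finsetSum_index (by simp) (by intros; ring), Q.eval_eq_sum_range]
    simp

theorem residue_identity_for_modified_tau_differential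
    (n q : ℕ) (hn : 1 ≤ n) (hq : 1 ≤ q) (d : Fin n → ℤ)
    (U : Matrix (Fin n) (Fin n) ℂ) (hU : IsUnit U)
    (A B C : Matrix (Fin n) (Fin n) (Polynomial ℂ)) :
    ∃ f : ℤ →₀ ℂ, f (-1) = 0 ∧ ∀ ζ : ℂ, ζ ≠ 0 →
      Matrix.trace
        (hatA n d U q A ζ
            * (hatConj n d U q B ζ * hatConj n d U q C ζ
               - hatConj n d U q C ζ * hatConj n d U q B ζ)
          + (Matrix.of fun i j => deriv (fun z => hatConj n d U q C z i j) ζ)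
            * hatConj n d U q B ζ)
        = ∑ k ∈ f.support, f k * ζ ^ k := by
  set P : Polynomial ℂ :=
    Matrix.trace (A * (B * C - C * B) + C.map Polynomial.derivative * B)
  obtain ⟨f, hf, hsum⟩ := Polynomial.exists_finsupp_eval_eq_sum_zpow
    (Polynomial.C (q : ℂ) * Polynomial.X ^ (q - 1) * P.comp (Polynomial.X ^ q))
  refine ⟨f, hf, fun ζ hζ => ?_⟩
  rw [← hsum]
  have hC : (Matrix.of fun i j => deriv (fun z => hatConj n d U q C z i j) ζ) = _ :=
    Matrix.ext fun i j => (hasDerivAt_hatConj d hU q C hζ i j).deriv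
  rw [hC]
  unfold hatA hatConj
  rw [Matrix.trace_gauge _ _ _ _ _ _ _ (Matrix.mul_nonsing_inv _ (gmat_isUnit_det d hU hζ)),
    Matrix.smul_mul, Matrix.smul_mul, ← smul_add, Matrix.trace_smul, smul_eq_mul]
  have hPeval : P.eval (ζ ^ q) = Matrix.trace
      (A.map (Polynomial.eval (ζ ^ q)) * (B.map (Polynomial.eval (ζ ^ q))
          * C.map (Polynomial.eval (ζ ^ q)) - C.map (Polynomial.eval (ζ ^ q))
          * B.map (Polynomial.eval (ζ ^ q)))
        + (C.map Polynomial.derivative).map (Polynomial.eval (ζ ^ q))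
          * B.map (Polynomial.eval (ζ ^ q))) := by
    have h := AddMonoidHom.map_trace (Polynomial.evalRingHom (ζ ^ q)).toAddMonoidHom
      (A * (B * C - C * B) + C.map Polynomial.derivative * B)
    refine h.trans (congrArg Matrix.trace ?_)
    change (Polynomial.evalRingHom (ζ ^ q)).mapMatrix _ = _
    simp only [map_add, map_sub, map_mul]
    rfl
  simp [hPeval]
end
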